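/- arXiv:2007.04909 — 2 statements merged into one kernel-verified Lean document; each statement's English description precedes it below -/
import Mathlib

section
/- In the deterministic model with payoffs Xₜⁿ = Rⁿ ρᵗ, suppose investor 1 uses the constant strategy R and investor 2 uses a constant strategy λ̃ ∈ Δ with λ̃ ≠ R. Then, with r̃ₜ = Yₜ²/(Yₜ¹ + Yₜ²) and r₀ the initial relative wealth of investor 1, for every t ≥ 1: ln(r̃ₜ / r̃_{t-1}) ≥ r̃_{t-1} (1 − ∑ₙ (λ̃ⁿ)² / (Rⁿ r₀)). Consequently τₗ² < ∞ for every l > 0, and with θ = ln ρ, limsup_{l→∞} θ τₗ² / ln l ≤ 1. -/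
open Filter
open scoped ENNReal BigOperators

/-- The standard simplex `Δ = {λ ∈ ℝ₊ᴺ : ∑ₙ λⁿ = 1}`. -/
def stdSimplex' (N : ℕ) : Set (Fin N → ℝ) := {x | (∀ n, 0 ≤ x n) ∧ ∑ n, x n = 1}

/-- The first time the (deterministic) wealth sequence `Y` reaches or exceeds the
level `l` (`= ∞` if this never happens). -/
noncomputable def dhit (Y : ℕ → ℝ) (l : ℝ) : ℝ≥0∞ :=
  sInf ((fun t : ℕ => (t : ℝ≥0∞)) '' {t : ℕ | l ≤ Y t})

lemma aux_core {N : ℕ} (R q : Fin N → ℝ) (hR : ∀ n, 0 < R n) (hRs : ∑ n, R n = 1)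
    (hq : ∀ n, 0 ≤ q n) (hqs : ∑ n, q n = 1) (a b : ℝ) (ha : 0 < a) (hb : 0 < b) :
    1 ≤ ∑ n, q n ^ 2 / R n ∧
    1 / (a + b * ∑ n, q n ^ 2 / R n) ≤ ∑ n, q n / (R n * a + q n * b) * R n := by
  have hK : 1 ≤ ∑ n, q n ^ 2 / R n := by
    have h : ∑ n, (2 * q n - R n) ≤ ∑ n, q n ^ 2 / R n := by
      apply Finset.sum_le_sum
      intro n _
      rw [le_div_iff₀ (hR n)]
      nlinarith [sq_nonneg (q n - R n)]
    rw [Finset.sum_sub_distrib, ← Finset.mul_sum, hRs, hqs] at h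
    linarith
  refine ⟨hK, ?_⟩
  set K := ∑ n, q n ^ 2 / R n with hKdef
  have hc : 0 < a + b * K := by nlinarith
  have h : ∑ n, (q n * (2 / (a + b * K)) - (q n * a + b * (q n ^ 2 / R n)) / (a + b * K) ^ 2)
      ≤ ∑ n, q n / (R n * a + q n * b) * R n := by
    apply Finset.sum_le_sum
    intro n _
    have hRn := hR n
    have hy : 0 < a + b * (q n / R n) := by
      have := div_nonneg (hq n) hRn.le
      nlinarith [mul_nonneg hb.le this]
    have e1 : q n / (R n * a + q n * b) * R n = q n * (1 / (a + b * (q n / R n))) := by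
      have : 0 < R n * a + q n * b := by nlinarith [mul_pos hRn ha, mul_nonneg (hq n) hb.le]
      field_simp
    have e2 : q n * (2 / (a + b * K)) - (q n * a + b * (q n ^ 2 / R n)) / (a + b * K) ^ 2
        = q n * (2 / (a + b * K) - (a + b * (q n / R n)) / (a + b * K) ^ 2) := by
      field_simp
    rw [e1, e2]
    apply mul_le_mul_of_nonneg_left _ (hq n)
    generalize a + b * (q n / R n) = y at *
    generalize a + b * K = c at *
    have : 1 / y - (2 / c - y / c ^ 2) = (c - y) ^ 2 / (y * c ^ 2) := by
      field_simp
      ring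
    have h2 : 0 ≤ (c - y) ^ 2 / (y * c ^ 2) := by positivity
    linarith
  refine le_trans (le_of_eq ?_) h
  rw [Finset.sum_sub_distrib, ← Finset.sum_mul, ← Finset.sum_div, Finset.sum_add_distrib,
    ← Finset.sum_mul, ← Finset.mul_sum, hqs, ← hKdef]
  field_simp
  ring

lemma aux_event (θ A D c : ℝ) (hθ : 0 < θ) (hc : 1 < c) :
    ∀ᶠ t : ℕ in atTop, (A + D * t) * Real.exp (θ * t / c) ≤ Real.exp (θ * t) := by
  have hb : 0 < θ * (1 - 1 / c) := by
    have : 1 / c < 1 := by rw [div_lt_one (by linarith)]; exact hc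
    apply mul_pos hθ; linarith
  have h1 : Tendsto (fun x : ℝ => (A + D * x) / Real.exp (θ * (1 - 1 / c) * x)) atTop (nhds 0) := by
    have h0 := (isLittleO_pow_exp_pos_mul_atTop 0 hb).tendsto_div_nhds_zero
    have h1 := (isLittleO_pow_exp_pos_mul_atTop 1 hb).tendsto_div_nhds_zero
    have := (h0.const_mul A).add (h1.const_mul D)
    simp only [mul_zero, add_zero] at this
    refine this.congr fun x => ?_
    simp only [pow_zero, pow_one]
    ring
  have h2 := (h1.comp tendsto_natCast_atTop_atTop).eventually (gt_mem_nhds (zero_lt_one))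
  filter_upwards [h2] with t ht
  simp only [Function.comp] at ht
  rw [div_lt_one (Real.exp_pos _)] at ht
  have : Real.exp (θ * t) = Real.exp (θ * (1 - 1 / c) * t) * Real.exp (θ * t / c) := by
    rw [← Real.exp_add]; congr 1; ring
  rw [this]
  exact mul_le_mul_of_nonneg_right ht.le (Real.exp_pos _).le

lemma dhit_le (Y : ℕ → ℝ) (l : ℝ) (t : ℕ) (h : l ≤ Y t) : dhit Y l ≤ t :=
  sInf_le ⟨t, h, rfl⟩

/-- In the deterministic model with payoffs `Xₜⁿ = Rⁿ ρᵗ`, if investor 1 uses the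
constant strategy `R` and investor 2 uses a constant strategy `λ̃ ∈ Δ`, `λ̃ ≠ R`,
then with `r̃ₜ = Yₜ²/(Yₜ¹+Yₜ²)` and `r₀` the initial relative wealth of investor 1:
`ln(r̃ₜ/r̃_{t-1}) ≥ r̃_{t-1}(1 − ∑ₙ (λ̃ⁿ)²/(Rⁿ r₀))` for all `t ≥ 1`; consequently
`τₗ² < ∞` for every `l > 0` and, with `θ = ln ρ`, `limsup_{l→∞} θ τₗ²/ln l ≤ 1`. -/
theorem deterministic_hitting_time_upper_bound
    {N : ℕ} (hN : 2 ≤ N) (ρ : ℝ) (hρ : 1 < ρ)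
    (R : Fin N → ℝ) (ε : ℝ) (hε : 0 < ε) (hRε : ∀ n, ε ≤ R n)
    (hRΔ : R ∈ stdSimplex' N)
    -- investor 2's constant strategy
    (tlam : Fin N → ℝ) (htlam : tlam ∈ stdSimplex' N)
    -- initial wealths, with total initial wealth W₀ = 1
    (Y10 Y20 : ℝ) (hY10 : 0 < Y10) (hY20 : 0 < Y20) (hW0 : Y10 + Y20 = 1)
    -- wealth dynamics: payoffs Xₜⁿ = Rⁿ ρᵗ, investor 1 uses the strategy R
    (Y1 Y2 : ℕ → ℝ) (hY1init : Y1 0 = Y10) (hY2init : Y2 0 = Y20)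
    (hY1rec : ∀ t : ℕ, Y1 (t + 1) = ∑ n,
      R n * Y1 t / (R n * Y1 t + tlam n * Y2 t) * (R n * ρ ^ (t + 1)))
    (hY2rec : ∀ t : ℕ, Y2 (t + 1) = ∑ n,
      tlam n * Y2 t / (R n * Y1 t + tlam n * Y2 t) * (R n * ρ ^ (t + 1)))
    (hne : tlam ≠ R) :
    (∀ t : ℕ,
      Real.log ((Y2 (t + 1) / (Y1 (t + 1) + Y2 (t + 1))) / (Y2 t / (Y1 t + Y2 t))) ≥
        (Y2 t / (Y1 t + Y2 t)) *
          (1 - ∑ n, (tlam n) ^ 2 / (R n * (Y10 / (Y10 + Y20))))) ∧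
    (∀ l : ℝ, 0 < l → dhit Y2 l ≠ ∞) ∧
    Filter.limsup (fun l : ℝ => Real.log ρ * (dhit Y2 l).toReal / Real.log l)
      Filter.atTop ≤ 1 := by
  have hR : ∀ n, 0 < R n := fun n => hε.trans_le (hRε n)
  obtain ⟨-, hRs⟩ := hRΔ
  obtain ⟨hq, hqs⟩ := htlam
  haveI : Nonempty (Fin N) := ⟨⟨0, by omega⟩⟩
  have hρ0 : 0 < ρ := by linarith
  set K := ∑ n, tlam n ^ 2 / R n with hKdef
  have key : ∀ t, 0 < Y1 t → 0 < Y2 t →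
      0 < Y1 (t + 1) ∧ Y1 (t + 1) + Y2 (t + 1) = ρ ^ (t + 1) ∧
      Y2 t * ρ ^ (t + 1) / (Y1 t + Y2 t * K) ≤ Y2 (t + 1) := by
    intro t h1 h2
    have hd : ∀ n, 0 < R n * Y1 t + tlam n * Y2 t := fun n => by
      nlinarith [mul_pos (hR n) h1, mul_nonneg (hq n) h2.le]
    refine ⟨?_, ?_, ?_⟩
    · rw [hY1rec]
      apply Finset.sum_pos _ Finset.univ_nonempty
      intro n _
      have := hd n
      have := hR n
      positivity
    · rw [hY1rec, hY2rec, ← Finset.sum_add_distrib]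
      calc _ = ∑ n, R n * ρ ^ (t + 1) := by
            apply Finset.sum_congr rfl
            intro n _
            have := (hd n).ne'
            rw [← add_mul, ← add_div, div_self this, one_mul]
        _ = _ := by rw [← Finset.sum_mul, hRs, one_mul]
    · have h := (aux_core R tlam hR hRs hq hqs (Y1 t) (Y2 t) h1 h2).2
      have hp : 0 ≤ Y2 t * ρ ^ (t + 1) := by positivity
      have h' := mul_le_mul_of_nonneg_left h hp
      rw [mul_one_div] at h'
      refine h'.trans (le_of_eq ?_)
      rw [hY2rec, Finset.mul_sum]
      apply Finset.sum_congr rfl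
      intro n _
      ring
  have hK : 1 ≤ K := (aux_core R tlam hR hRs hq hqs 1 1 one_pos one_pos).1
  have inv : ∀ t, 0 < Y1 t ∧ 0 < Y2 t ∧ Y1 t + Y2 t = ρ ^ t := by
    intro t
    induction t with
    | zero => simp [hY1init, hY2init, hY10, hY20, hW0]
    | succ t ih =>
      obtain ⟨h1, h2, -⟩ := ih
      obtain ⟨k1, k2, k3⟩ := key t h1 h2
      refine ⟨k1, lt_of_lt_of_le ?_ k3, k2⟩
      have : 0 < Y1 t + Y2 t * K := by nlinarith
      positivity
  have growth : ∀ t : ℕ, ρ ^ t ≤ (1 / Y20 + (K - 1) * t) * Y2 t := by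
    intro t
    induction t with
    | zero => simp [hY2init, hY20.ne']
    | succ t ih =>
      obtain ⟨h1, h2, h3⟩ := inv t
      obtain ⟨-, h2', -⟩ := inv (t + 1)
      obtain ⟨-, -, k3⟩ := key t h1 h2
      have hd : 0 < Y1 t + Y2 t * K := by nlinarith
      rw [div_le_iff₀ hd] at k3
      have e : Y1 t + Y2 t * K ≤ (1 / Y20 + (K - 1) * (t + 1)) * Y2 t := by
        nlinarith
      have h5 := k3.trans (mul_le_mul_of_nonneg_left e h2'.le)
      have h6 : Y2 t * ρ ^ (t + 1) ≤
          Y2 t * ((1 / Y20 + (K - 1) * (t + 1)) * Y2 (t + 1)) := by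
        refine h5.trans (le_of_eq ?_); ring
      push_cast
      exact le_of_mul_le_mul_left h6 h2
  have hθ : 0 < Real.log ρ := Real.log_pos hρ
  have hexp : ∀ t : ℕ, ρ ^ t = Real.exp (Real.log ρ * t) := by
    intro t
    rw [mul_comm, Real.exp_nat_mul, Real.exp_log hρ0]
  have ev : ∀ c : ℝ, 1 < c → ∀ᶠ t : ℕ in atTop, Real.exp (Real.log ρ * t / c) ≤ Y2 t := by
    intro c hc
    filter_upwards [aux_event (Real.log ρ) (1 / Y20) (K - 1) c hθ hc] with t ht
    have hA : 0 < 1 / Y20 + (K - 1) * t := by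
      have : 0 ≤ (K - 1) * t := mul_nonneg (by linarith) (Nat.cast_nonneg t)
      positivity
    have := growth t
    rw [hexp] at this
    exact le_of_mul_le_mul_left (ht.trans this) hA
  have hit : ∀ c : ℝ, 1 < c → ∀ᶠ l : ℝ in atTop,
      dhit Y2 l ≤ ((⌈c * Real.log l / Real.log ρ⌉₊ : ℕ) : ℝ≥0∞) := by
    intro c hc
    have ht : Tendsto (fun l : ℝ => ⌈c * Real.log l / Real.log ρ⌉₊) atTop atTop := by
      apply tendsto_nat_ceil_atTop.comp
      exact (Real.tendsto_log_atTop.const_mul_atTop (by linarith)).atTop_div_const hθ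
    filter_upwards [ht.eventually (ev c hc), eventually_gt_atTop 0] with l h1 h2
    apply dhit_le
    refine le_trans ?_ h1
    rw [← Real.log_le_iff_le_exp h2, le_div_iff₀ (by linarith)]
    have := Nat.le_ceil (c * Real.log l / Real.log ρ)
    rw [div_le_iff₀ hθ] at this
    linarith
  refine ⟨?_, ?_, ?_⟩
  · intro t
    obtain ⟨h1, h2, h3⟩ := inv t
    obtain ⟨h1', h2', h3'⟩ := inv (t + 1)
    obtain ⟨-, -, k3⟩ := key t h1 h2
    have hd : 0 < Y1 t + Y2 t * K := by nlinarith
    have hW : 0 < ρ ^ (t + 1) := by positivity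
    set r := Y2 t / (Y1 t + Y2 t) with hr
    have hr0 : 0 < r := by positivity
    have hx : 0 < (Y1 t + Y2 t * K) / (Y1 t + Y2 t) := by positivity
    have hle : ((Y1 t + Y2 t * K) / (Y1 t + Y2 t))⁻¹ ≤
        (Y2 (t + 1) / (Y1 (t + 1) + Y2 (t + 1))) / r := by
      rw [h3', inv_div, le_div_iff₀ hr0, le_div_iff₀ hW]
      refine le_trans (le_of_eq ?_) k3
      rw [hr]
      have : Y1 t + Y2 t ≠ 0 := by positivity
      field_simp
    have hlog := Real.log_le_log (inv_pos.mpr hx) hle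
    rw [Real.log_inv] at hlog
    have hl2 := Real.log_le_sub_one_of_pos hx
    have hx2 : (Y1 t + Y2 t * K) / (Y1 t + Y2 t) - 1 = r * (K - 1) := by
      rw [hr]
      have : Y1 t + Y2 t ≠ 0 := by positivity
      field_simp
      ring
    have hKK : K ≤ ∑ n, (tlam n) ^ 2 / (R n * (Y10 / (Y10 + Y20))) := by
      rw [hW0, div_one]
      apply Finset.sum_le_sum
      intro n _
      have := hR n
      apply div_le_div_of_nonneg_left (sq_nonneg _) (by positivity)
      nlinarith
    have := mul_le_mul_of_nonneg_left hKK hr0.le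
    rw [ge_iff_le]
    nlinarith
  · intro l hl
    have h := hit 2 (by norm_num)
    obtain ⟨l', hl', hle⟩ := (h.and (eventually_ge_atTop l)).exists
    have hmono : dhit Y2 l ≤ dhit Y2 l' := by
      apply sInf_le_sInf
      apply Set.image_mono
      intro t ht
      exact hle.trans ht
    exact ne_top_of_le_ne_top (ENNReal.natCast_ne_top _) (hmono.trans hl')
  · apply le_of_forall_gt_imp_ge_of_dense
    intro c hc
    apply Filter.limsup_le_of_le
    · apply IsBoundedUnder.isCoboundedUnder_le
      refine ⟨0, ?_⟩
      rw [eventually_map]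
      filter_upwards [eventually_ge_atTop 1] with l hl
      have := Real.log_nonneg hl
      positivity
    · filter_upwards [hit ((1 + c) / 2) (by linarith), eventually_gt_atTop 1,
        Real.tendsto_log_atTop.eventually_ge_atTop (Real.log ρ / ((c - 1) / 2))] with l h1 h2 h3
      have hl := Real.log_pos h2
      rw [div_le_iff₀ (by linarith)] at h3
      rw [div_le_iff₀ hl]
      have h4 := ENNReal.toReal_mono (ENNReal.natCast_ne_top _) h1
      rw [ENNReal.toReal_natCast] at h4
      have h5 := Nat.ceil_lt_add_one
        (show 0 ≤ (1 + c) / 2 * Real.log l / Real.log ρ by positivity)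
      have h6 := mul_le_mul_of_nonneg_left (h4.trans h5.le) hθ.le
      rw [mul_add, mul_div_cancel₀ _ hθ.ne'] at h6
      linarith
end

section
/- In the asset market model with M ≥ 2 investors, suppose investor 1 uses an adapted Δ-valued strategy λₜ¹ and the other investors use adapted Δ-valued strategies λₜᵐ, m = 2,…,M. Define the representative investor by Ỹₜ = ∑_{m≥2} Yₜᵐ and λ̃ₜⁿ = ∑_{m≥2} (r_{t-1}ᵐ / (1 − r_{t-1}¹)) λₜᵐ,ⁿ, where rₜᵐ = Yₜᵐ / Wₜ and λ̃ₜⁿ = 0 when r_{t-1}¹ = 1. Then, provided λₜ¹,ⁿ > 0 for all t, n (so that Wₜ > 0), the wealth of investor 1 satisfies Yₜ¹ = ∑ₙ λₜ¹,ⁿ Y_{t-1}¹ Xₜⁿ / (λₜ¹,ⁿ Y_{t-1}¹ + λ̃ₜⁿ Ỹ_{t-1}), i.e. the two-investor wealth equation with opponents aggregated into a single investor with wealth Ỹₜ and strategy λ̃ₜ; moreover, τ̃ₗ := min{t ≥ 0 : Ỹₜ ≥ l} satisfies τ̃ₗ ≤ τₗᵐ for every m ≥ 2 and every l > 0. -/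
open MeasureTheory ProbabilityTheory Filter
open scoped ENNReal BigOperators

/-- The first time the wealth sequence `Y` reaches or exceeds the level `l`. -/
noncomputable def hitTime {Ω : Type*} (Y : ℕ → Ω → ℝ) (l : ℝ) (ω : Ω) : ℝ≥0∞ :=
  sInf ((fun t : ℕ => (t : ℝ≥0∞)) '' {t : ℕ | l ≤ Y t ω})

/-- The representative investor: aggregating investors `2, …, M` into a single investor
with wealth `Ỹₜ = ∑_{m≥2} Yₜᵐ` and strategy `λ̃ₜⁿ = ∑_{m≥2} (r_{t-1}ᵐ/(1−r_{t-1}¹)) λₜᵐⁿ`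
(`= 0` when `r_{t-1}¹ = 1`), the wealth of investor 1 satisfies the two-investor
wealth equation `Yₜ¹ = ∑ₙ λₜ¹ⁿ Y_{t-1}¹ Xₜⁿ / (λₜ¹ⁿ Y_{t-1}¹ + λ̃ₜⁿ Ỹ_{t-1})`,
provided `λₜ¹ⁿ > 0` for all `t, n`; moreover `τ̃ₗ ≤ τₗᵐ` for every `m ≥ 2`, `l > 0`. -/
theorem representative_investor
    {Ω : Type*} {m0 : MeasurableSpace Ω} (P : Measure Ω) [IsProbabilityMeasure P]
    (ℱ : Filtration ℕ m0) {M N : ℕ} (hM : 2 ≤ M) (hN : 2 ≤ N)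
    -- payoffs: adapted, nonnegative, with positive total payoff
    (X : ℕ → Fin N → Ω → ℝ)
    (hX_adapted : ∀ t n, StronglyMeasurable[ℱ (t + 1)] (X (t + 1) n))
    (hX_nonneg : ∀ t n ω, 0 ≤ X (t + 1) n ω)
    (hX_pos : ∀ t ω, 0 < ∑ n, X (t + 1) n ω)
    -- initial wealths and investment proportions (predictable, Δ-valued)
    (Y0 : Fin M → ℝ) (hY0 : ∀ m, 0 < Y0 m)
    (lam : Fin M → ℕ → Fin N → Ω → ℝ)
    (hlam_adapted : ∀ m t n, StronglyMeasurable[ℱ t] (lam m (t + 1) n))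
    (hlam_simplex : ∀ m t ω, (fun n => lam m (t + 1) n ω) ∈ stdSimplex' N)
    -- the wealth dynamics
    (Y : Fin M → ℕ → Ω → ℝ)
    (hYinit : ∀ m ω, Y m 0 ω = Y0 m)
    (hYrec : ∀ m t ω, Y m (t + 1) ω =
      ∑ n, lam m (t + 1) n ω * Y m t ω / (∑ k, lam k (t + 1) n ω * Y k t ω) *
        X (t + 1) n ω)
    -- investor 1, whose strategy is fully diversified
    (m1 : Fin M) (hm1 : (m1 : ℕ) = 0)
    (hlam1_pos : ∀ t n ω, 0 < lam m1 (t + 1) n ω)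
    -- the representative investor's wealth and strategy
    (tY : ℕ → Ω → ℝ)
    (htY : ∀ t ω, tY t ω = ∑ m ∈ Finset.univ.filter (fun m => m ≠ m1), Y m t ω)
    (tlam : ℕ → Fin N → Ω → ℝ)
    (htlam : ∀ t n ω, tlam (t + 1) n ω =
      ∑ m ∈ Finset.univ.filter (fun m => m ≠ m1),
        (Y m t ω / ∑ k, Y k t ω) / (1 - Y m1 t ω / ∑ k, Y k t ω) *
          lam m (t + 1) n ω) :
    (∀ t ω, Y m1 (t + 1) ω =
      ∑ n, lam m1 (t + 1) n ω * Y m1 t ω /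
        (lam m1 (t + 1) n ω * Y m1 t ω + tlam (t + 1) n ω * tY t ω) *
          X (t + 1) n ω) ∧
    ∀ m : Fin M, m ≠ m1 → ∀ l : ℝ, 0 < l → ∀ ω,
      hitTime tY l ω ≤ hitTime (Y m) l ω := by
  have hl : ∀ m t n ω, 0 ≤ lam m (t + 1) n ω := fun m t n ω => (hlam_simplex m t ω).1 n
  have hYn : ∀ t m ω, 0 ≤ Y m t ω := by
    intro t
    induction t with
    | zero => intro m ω; rw [hYinit]; exact (hY0 m).le
    | succ t ih =>
      intro m ω
      rw [hYrec]
      exact Finset.sum_nonneg fun n _ => mul_nonneg (div_nonneg (mul_nonneg (hl _ _ _ _) (ih _ _))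
        (Finset.sum_nonneg fun k _ => mul_nonneg (hl _ _ _ _) (ih _ _))) (hX_nonneg _ _ _)
  have hYp : ∀ t ω, 0 < Y m1 t ω := by
    intro t ω
    induction t with
    | zero => rw [hYinit]; exact hY0 m1
    | succ t ih =>
      rw [hYrec]
      obtain ⟨n, -, hn⟩ := Finset.exists_lt_of_sum_lt
        (f := fun _ => (0 : ℝ)) (g := fun n => X (t + 1) n ω) (s := Finset.univ)
        (by simpa using hX_pos t ω)
      have hD : ∀ n, 0 < ∑ k, lam k (t + 1) n ω * Y k t ω := fun n =>
        Finset.sum_pos' (fun k _ => mul_nonneg (hl _ _ _ _) (hYn _ _ _))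
          ⟨m1, Finset.mem_univ _, mul_pos (hlam1_pos _ _ _) ih⟩
      refine Finset.sum_pos' (fun n _ => mul_nonneg (div_nonneg
        (mul_nonneg (hl _ _ _ _) (hYn _ _ _)) (hD n).le) (hX_nonneg _ _ _))
        ⟨n, Finset.mem_univ _, mul_pos (div_pos (mul_pos (hlam1_pos _ _ _) ih) (hD n)) hn⟩
  have hsplit : ∀ f : Fin M → ℝ,
      ∑ k, f k = f m1 + ∑ m ∈ Finset.univ.filter (fun m => m ≠ m1), f m := by
    intro f
    rw [Finset.filter_ne', Finset.add_sum_erase _ _ (Finset.mem_univ _)]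
  constructor
  · intro t ω
    rw [hYrec]
    refine Finset.sum_congr rfl fun n _ => ?_
    have key : tlam (t + 1) n ω * tY t ω =
        ∑ m ∈ Finset.univ.filter (fun m => m ≠ m1), lam m (t + 1) n ω * Y m t ω := by
      rw [htlam, Finset.sum_mul]
      refine Finset.sum_congr rfl fun m hm => ?_
      have hW : ∑ k, Y k t ω = Y m1 t ω + tY t ω := by rw [htY, hsplit]
      have hle : Y m t ω ≤ tY t ω := by
        rw [htY]
        exact Finset.single_le_sum (f := fun m => Y m t ω) (fun k _ => hYn t k ω) hm
      have h0 := hYn t m ω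
      have h1 := hYp t ω
      rw [hW]
      rcases eq_or_lt_of_le (h0.trans hle) with h | h
      · have : Y m t ω = 0 := by linarith
        simp [this]
      · have hWp : Y m1 t ω + tY t ω ≠ 0 := by positivity
        have e : 1 - Y m1 t ω / (Y m1 t ω + tY t ω) = tY t ω / (Y m1 t ω + tY t ω) := by
          field_simp
          ring
        rw [e]
        field_simp
    rw [key, hsplit (fun k => lam k (t + 1) n ω * Y k t ω)]
  · intro m hm l _ ω
    unfold hitTime
    refine sInf_le_sInf (Set.image_mono fun t ht => ?_)
    simp only [Set.mem_setOf_eq] at ht ⊢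
    refine ht.trans ?_
    rw [htY]
    exact Finset.single_le_sum (f := fun m => Y m t ω) (fun k _ => hYn t k ω) (by simp [hm])
end
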